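/- Almost surely, as the integer n → ∞, (e^{−α n}/n) ∫_0^n L̃(s) X_s ds converges to (A_∞/α + Z_∞) · ∫_0^1 L(s) ds, where L̃(t) := ∫_0^t L(s) ds. -/

import Mathlib

open MeasureTheory ProbabilityTheory Filter

lemma aux_conv1 {α : ℝ} (hα : 0 < α) (l g : ℝ → ℝ) (hl : Continuous l) (hg : Continuous g)
    {M C m c : ℝ} (hlM : ∀ t, |l t| ≤ M * |t|) (hgC : ∀ t, 0 ≤ t → |g t| ≤ C)
    (hlm : Tendsto (fun t => l t / t) atTop (nhds m)) (hgc : Tendsto g atTop (nhds c)) :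
    Tendsto (fun n : ℕ => Real.exp (-α * n) / n *
      ∫ s in (0:ℝ)..(n:ℝ), l s * (Real.exp (α * s) * g s)) atTop (nhds (c / α * m)) := by
  have hM : 0 ≤ M := by simpa using (abs_nonneg _).trans (hlM 1)
  have hC : 0 ≤ C := (abs_nonneg _).trans (hgC 0 le_rfl)
  have key : Tendsto (fun n : ℕ => ∫ u in Set.Ioi (0:ℝ), (Set.Ioc (0:ℝ) n).indicator
      (fun u => Real.exp (-α * u) * ((l (n - u) / n) * g (n - u))) u) atTop
      (nhds (∫ u in Set.Ioi (0:ℝ), Real.exp (-α * u) * (m * c))) := by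
    apply tendsto_integral_of_dominated_convergence (fun u => Real.exp (-α * u) * (M * C))
    · intro n
      apply AEStronglyMeasurable.indicator _ measurableSet_Ioc
      exact (by fun_prop : Continuous (fun u => Real.exp (-α * u) *
        ((l (n - u) / n) * g (n - u)))).aestronglyMeasurable
    · exact (exp_neg_integrableOn_Ioi 0 hα).mul_const _
    · intro n
      refine Eventually.of_forall fun u => ?_
      by_cases hu : u ∈ Set.Ioc (0:ℝ) n
      · rw [Set.indicator_of_mem hu]
        have hn : (0:ℝ) < n := hu.1.trans_le hu.2
        have h0 : 0 ≤ (n:ℝ) - u := sub_nonneg.2 hu.2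
        rw [norm_mul, norm_mul, Real.norm_of_nonneg (Real.exp_pos _).le]
        gcongr
        · rw [Real.norm_eq_abs, abs_div, abs_of_pos hn, div_le_iff₀ hn]
          refine (hlM _).trans ?_
          rw [abs_of_nonneg h0]
          have := hu.1
          gcongr
          linarith
        · exact hgC _ h0
      · rw [Set.indicator_of_notMem hu, norm_zero]
        positivity
    · refine (ae_restrict_iff' measurableSet_Ioi).2 (Eventually.of_forall fun u hu => ?_)
      have hu : 0 < u := hu
      have ht : Tendsto (fun n : ℕ => (n:ℝ) - u) atTop atTop :=
        tendsto_atTop_add_const_right _ (-u) tendsto_natCast_atTop_atTop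
      have hq : Tendsto (fun n : ℕ => ((n:ℝ) - u) / n) atTop (nhds 1) := by
        have : Tendsto (fun n : ℕ => 1 - u / (n:ℝ)) atTop (nhds (1 - 0)) :=
          tendsto_const_nhds.sub (tendsto_const_div_atTop_nhds_zero_nat u)
        rw [sub_zero] at this
        refine this.congr' ?_
        filter_upwards [eventually_gt_atTop 0] with n hn
        have : (n:ℝ) ≠ 0 := by positivity
        field_simp
      have h1 : Tendsto (fun n : ℕ => Real.exp (-α * u) *
          ((l (n - u) / (n - u)) * (((n:ℝ) - u) / n) * g (n - u))) atTop
          (nhds (Real.exp (-α * u) * (m * 1 * c))) :=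
        tendsto_const_nhds.mul (((hlm.comp ht).mul hq).mul (hgc.comp ht))
      rw [mul_one] at h1
      refine h1.congr' ?_
      filter_upwards [ht.eventually_gt_atTop 0] with n hn
      rw [Set.indicator_of_mem (show u ∈ Set.Ioc (0:ℝ) n from ⟨hu, by linarith⟩)]
      have : (n:ℝ) - u ≠ 0 := hn.ne'
      have : (n:ℝ) ≠ 0 := by linarith
      congr 2
      field_simp
  have hval : ∫ u in Set.Ioi (0:ℝ), Real.exp (-α * u) * (m * c) = c / α * m := by
    rw [integral_mul_const, integral_exp_mul_Ioi (by linarith)]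
    simp
    field_simp
  rw [hval] at key
  refine key.congr fun n => ?_
  rw [setIntegral_indicator measurableSet_Ioc]
  have : Set.Ioi (0:ℝ) ∩ Set.Ioc 0 (n:ℝ) = Set.Ioc 0 (n:ℝ) :=
    Set.inter_eq_right.2 fun x hx => hx.1
  rw [this, ← intervalIntegral.integral_of_le n.cast_nonneg]
  have h2 := intervalIntegral.integral_comp_sub_left (a := 0) (b := n)
    (fun s => l s * (Real.exp (α * s) * g s)) (n:ℝ)
  simp only [sub_self, sub_zero] at h2
  rw [← h2, ← intervalIntegral.integral_const_mul]
  congr 1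
  ext u
  have : Real.exp (-α * u) = Real.exp (-α * n) * Real.exp (α * (n - u)) := by
    rw [← Real.exp_add]; ring_nf
  rw [this]
  ring

lemma aux_conv2 {α : ℝ} (hα : 0 < α) (l b : ℝ → ℝ) (hl : Continuous l) (hb : Continuous b)
    {M : ℝ} (hlM : ∀ t, |l t| ≤ M * |t|)
    (hbi : IntegrableOn (fun s => Real.exp (-α * s) * b s) (Set.Ioi 0)) :
    Tendsto (fun n : ℕ => Real.exp (-α * n) / n *
      ∫ s in (0:ℝ)..(n:ℝ), l s * b s) atTop (nhds 0) := by
  have hM : 0 ≤ M := by simpa using (abs_nonneg _).trans (hlM 1)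
  have key : Tendsto (fun n : ℕ => ∫ s in Set.Ioi (0:ℝ), (Set.Ioc (0:ℝ) n).indicator
      (fun s => Real.exp (-α * n) / n * (l s * b s)) s) atTop
      (nhds (∫ u in Set.Ioi (0:ℝ), (0:ℝ))) := by
    apply tendsto_integral_of_dominated_convergence (fun s => M * ‖Real.exp (-α * s) * b s‖)
    · intro n
      apply AEStronglyMeasurable.indicator _ measurableSet_Ioc
      exact (by fun_prop : Continuous (fun s => Real.exp (-α * n) / n * (l s * b s)
        )).aestronglyMeasurable
    · exact hbi.norm.const_mul _
    · intro n
      refine Eventually.of_forall fun u => ?_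
      by_cases hu : u ∈ Set.Ioc (0:ℝ) n
      · rw [Set.indicator_of_mem hu]
        have hn : (0:ℝ) < n := hu.1.trans_le hu.2
        have h1 : |l u| / n ≤ M := by
          rw [div_le_iff₀ hn]
          refine (hlM _).trans ?_
          rw [abs_of_pos hu.1]
          have := hu.2
          gcongr
        have h2 : Real.exp (-α * n) ≤ Real.exp (-α * u) := by
          apply Real.exp_le_exp.2
          nlinarith [hu.2]
        have : ‖Real.exp (-α * n) / n * (l u * b u)‖ =
            |l u| / n * (Real.exp (-α * n) * |b u|) := by
          simp only [norm_mul, norm_div, Real.norm_eq_abs, Real.abs_exp, abs_of_pos hn]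
          ring
        rw [this, norm_mul, Real.norm_eq_abs, Real.norm_eq_abs, Real.abs_exp]
        gcongr
      · rw [Set.indicator_of_notMem hu, norm_zero]
        positivity
    · refine (ae_restrict_iff' measurableSet_Ioi).2 (Eventually.of_forall fun u hu => ?_)
      have hu : 0 < u := hu
      have hz : Tendsto (fun n : ℕ => Real.exp (-α * n) / n * (l u * b u)) atTop (nhds 0) := by
        have h1 : Tendsto (fun n : ℕ => Real.exp (-α * n)) atTop (nhds 0) := by
          refine Real.tendsto_exp_atBot.comp ?_
          exact tendsto_natCast_atTop_atTop.const_mul_atTop_of_neg (by linarith)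
        have h2 := (h1.mul (tendsto_const_div_atTop_nhds_zero_nat 1)).mul_const (l u * b u)
        simp only [zero_mul] at h2
        refine h2.congr fun n => ?_
        ring
      refine hz.congr' ?_
      filter_upwards [eventually_ge_atTop ⌈u⌉₊] with n hn
      rw [Set.indicator_of_mem (show u ∈ Set.Ioc (0:ℝ) n from ⟨hu, Nat.ceil_le.1 hn⟩)]
  rw [integral_zero] at key
  refine key.congr fun n => ?_
  rw [setIntegral_indicator measurableSet_Ioc]
  have : Set.Ioi (0:ℝ) ∩ Set.Ioc 0 (n:ℝ) = Set.Ioc 0 (n:ℝ) :=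
    Set.inter_eq_right.2 fun x hx => hx.1
  rw [this, ← intervalIntegral.integral_of_le n.cast_nonneg, intervalIntegral.integral_const_mul]

lemma aux_int {Ω : Type*} [MeasurableSpace Ω] (P : Measure Ω) [IsProbabilityMeasure P]
    (H : ℝ) (hH1 : 1 / 2 ≤ H)
    (B : ℝ → Ω → ℝ)
    (hBmeas : ∀ t : ℝ, Measurable (B t))
    (hBcov : ∀ s t : ℝ, 0 ≤ s → 0 ≤ t →
      ∫ ω, B s ω * B t ω ∂P = 1 / 2 * (s ^ (2 * H) + t ^ (2 * H) - |t - s| ^ (2 * H)))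
    (hBcont : ∀ᵐ ω ∂P, ContinuousOn (fun t => B t ω) (Set.Ici (0 : ℝ)))
    (α : ℝ) (hα : 0 < α) :
    ∀ᵐ ω ∂P, IntegrableOn (fun s => Real.exp (-α * s) * B (max s 0) ω) (Set.Ioi 0) := by
  obtain ⟨G, hG, hGm, hGc⟩ := hBcont.exists_measurable_mem
  let B' : ℝ → Ω → ℝ := fun t => G.indicator (B (max t 0))
  have hB'm : ∀ t, Measurable (B' t) := fun t => (hBmeas _).indicator hGm
  have hB'c : ∀ ω, Continuous fun t => B' t ω := by
    intro ω
    by_cases h : ω ∈ G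
    · simp only [B', Set.indicator_of_mem h]
      exact (hGc ω h).comp_continuous (by fun_prop) (fun t => Set.mem_Ici.2 (le_max_right _ _))
    · simp only [B', Set.indicator_of_notMem h]
      exact continuous_const
  have hjm : Measurable (Function.uncurry B') :=
    measurable_uncurry_of_continuous_of_measurable hB'c hB'm
  let F : ℝ → Ω → ENNReal := fun s ω => ENNReal.ofReal (Real.exp (-α * s) * |B' s ω|)
  have hFm : Measurable (Function.uncurry F) := by
    have : Function.uncurry F = fun p : ℝ × Ω =>
      ENNReal.ofReal (Real.exp (-α * p.1) * |Function.uncurry B' p|) := rfl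
    rw [this]
    have h1 : Measurable fun p : ℝ × Ω => |Function.uncurry B' p| :=
      continuous_abs.measurable.comp hjm
    have h2 : Measurable fun p : ℝ × Ω => Real.exp (-α * p.1) := by fun_prop
    exact (h2.mul h1).ennreal_ofReal
  have hbound : ∀ s : ℝ, 0 < s → ∫⁻ ω, F s ω ∂P ≤
      ENNReal.ofReal (Real.exp (-α * s) * (1 + s ^ (2 * H))) := by
    intro s hs
    have hcv := hBcov s s hs.le hs.le
    have hval : ∫ ω, B s ω * B s ω ∂P = s ^ (2 * H) := by
      rw [hcv, sub_self, abs_zero, Real.zero_rpow (by linarith)]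
      ring
    have hint : Integrable (fun ω => B s ω * B s ω) P := by
      apply Integrable.of_integral_ne_zero
      rw [hval]
      exact (Real.rpow_pos_of_pos hs _).ne'
    have hint2 : Integrable (fun ω => Real.exp (-α * s) * (1 + B s ω * B s ω)) P :=
      ((integrable_const 1).add hint).const_mul _
    have hval2 : ∫ ω, Real.exp (-α * s) * (1 + B s ω * B s ω) ∂P =
        Real.exp (-α * s) * (1 + s ^ (2 * H)) := by
      rw [integral_const_mul, integral_add (integrable_const 1) hint, hval]
      simp
    rw [← hval2, ofReal_integral_eq_lintegral_ofReal hint2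
      (Eventually.of_forall fun ω => by
        have := mul_self_nonneg (B s ω)
        have := Real.exp_pos (-α * s)
        simp only [Pi.zero_apply]
        positivity)]
    apply lintegral_mono
    intro ω
    apply ENNReal.ofReal_le_ofReal
    have h3 : |B' s ω| ≤ |B s ω| := by
      by_cases h : ω ∈ G
      · simp only [B', Set.indicator_of_mem h, max_eq_left hs.le]; exact le_rfl
      · simp only [B', Set.indicator_of_notMem h, abs_zero]; exact abs_nonneg _
    have h4 : |B s ω| ≤ 1 + B s ω * B s ω := by
      rw [← abs_mul_abs_self]
      nlinarith [abs_nonneg (B s ω)]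
    have := Real.exp_pos (-α * s)
    gcongr
    exact h3.trans h4
  have hfin : ∫⁻ s in Set.Ioi (0:ℝ), ∫⁻ ω, F s ω ∂P < ⊤ := by
    have hI : IntegrableOn (fun s : ℝ => Real.exp (-α * s) * (1 + s ^ (2 * H))) (Set.Ioi 0) := by
      have h1 := exp_neg_integrableOn_Ioi 0 hα
      have h2 := integrableOn_rpow_mul_exp_neg_mul_rpow (p := 1) (s := 2 * H) (b := α)
        (by linarith) one_pos hα
      refine (h1.add h2).congr (Eventually.of_forall fun s => ?_)
      simp only [Pi.add_apply, Real.rpow_one]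
      ring
    refine lt_of_le_of_lt (setLIntegral_mono' measurableSet_Ioi hbound) ?_
    exact hI.lintegral_lt_top
  rw [lintegral_lintegral_swap hFm.aemeasurable] at hfin
  have hae := ae_lt_top (hFm.lintegral_prod_left') hfin.ne
  filter_upwards [hae, hG] with ω hω hωG
  have hc : Continuous fun t => B (max t 0) ω := by
    have := hB'c ω
    simpa only [B', Set.indicator_of_mem hωG] using this
  refine ⟨((by fun_prop : Continuous fun s => Real.exp (-α * s)).mul hc).aestronglyMeasurable, ?_⟩
  rw [hasFiniteIntegral_iff_norm]
  refine lt_of_le_of_lt (le_of_eq ?_) hω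
  refine lintegral_congr fun s => ?_
  simp only [F, B', Set.indicator_of_mem hωG, Function.uncurry, norm_mul, Real.norm_eq_abs,
    Real.abs_exp]

lemma aux_L {L : ℝ → ℝ} (hLi : ∀ a b, IntervalIntegrable L volume a b)
    (hLper : ∀ t : ℝ, L (t + 1) = L t) :
    Tendsto (fun t => (∫ r in (0:ℝ)..t, L r) / t) atTop (nhds (∫ r in (0:ℝ)..1, L r)) := by
  set m := ∫ r in (0:ℝ)..1, L r with hm
  have hcont : Continuous fun t => (∫ r in (0:ℝ)..t, L r) - t * m :=
    (intervalIntegral.continuous_primitive hLi 0).sub (by fun_prop)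
  have hper : Function.Periodic (fun t => (∫ r in (0:ℝ)..t, L r) - t * m) 1 := by
    intro t
    have h1 : (∫ r in (0:ℝ)..(t+1), L r) = (∫ r in (0:ℝ)..t, L r) + ∫ r in t..(t+1), L r :=
      (intervalIntegral.integral_add_adjacent_intervals (hLi _ _) (hLi _ _)).symm
    have h2 := Function.Periodic.intervalIntegral_add_eq (f := L) (T := 1) hLper t 0
    rw [zero_add] at h2
    simp only [h1, h2, ← hm]
    ring
  have hbd := hper.isBounded_of_continuous one_ne_zero hcont
  obtain ⟨D, hD⟩ := hbd.exists_norm_le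
  have h0 : Tendsto (fun t => t⁻¹ * ((∫ r in (0:ℝ)..t, L r) - t * m)) atTop (nhds 0) := by
    apply squeeze_zero_norm' (a := fun t => |t⁻¹| * D)
    · refine Eventually.of_forall fun t => ?_
      rw [norm_mul, Real.norm_eq_abs]
      gcongr
      exact hD _ ⟨t, rfl⟩
    · have := (tendsto_inv_atTop_zero (𝕜 := ℝ)).abs.mul_const D
      simpa using this
  have h1 := h0.add_const m
  rw [zero_add] at h1
  refine h1.congr' ?_
  filter_upwards [eventually_gt_atTop 0] with t ht
  field_simp
  ring

lemma aux_A {α : ℝ} (hα : 0 < α) {L : ℝ → ℝ}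
    (hi : ∀ a b, IntervalIntegrable (fun s => Real.exp (-α * s) * L s) volume a b)
    (hI : IntegrableOn (fun s => Real.exp (-α * s) * L s) (Set.Ioi 0))
    (hLper : ∀ t : ℝ, L (t + 1) = L t) :
    ∫ s in Set.Ioi (0:ℝ), Real.exp (-α * s) * L s =
      (∫ s in (0:ℝ)..1, Real.exp (-α * s) * L s) / (1 - Real.exp (-α)) := by
  set I := ∫ s in Set.Ioi (0:ℝ), Real.exp (-α * s) * L s
  have h1 := intervalIntegral_tendsto_integral_Ioi 0 hI tendsto_id
  have h2 := intervalIntegral_tendsto_integral_Ioi 0 hI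
    (tendsto_atTop_add_const_right atTop (1:ℝ) tendsto_id)
  simp only [id] at h1 h2
  have h3 : ∀ t : ℝ, ∫ s in (0:ℝ)..(t+1), Real.exp (-α * s) * L s =
      (∫ s in (0:ℝ)..1, Real.exp (-α * s) * L s) +
        Real.exp (-α) * ∫ s in (0:ℝ)..t, Real.exp (-α * s) * L s := by
    intro t
    rw [← intervalIntegral.integral_add_adjacent_intervals (hi 0 1) (hi 1 (t+1))]
    congr 1
    have := intervalIntegral.integral_comp_add_right (a := 0) (b := t)
      (fun s => Real.exp (-α * s) * L s) 1
    rw [zero_add] at this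
    rw [← this, ← intervalIntegral.integral_const_mul]
    congr 1
    ext s
    rw [hLper, mul_add, Real.exp_add, mul_one]
    ring
  have h4 := (h1.const_mul (Real.exp (-α))).const_add (∫ s in (0:ℝ)..1, Real.exp (-α * s) * L s)
  have h5 := tendsto_nhds_unique h2 (h4.congr fun t => (h3 t).symm)
  have : Real.exp (-α) < 1 := by rw [Real.exp_lt_one_iff]; linarith
  rw [eq_div_iff (by linarith)]
  linarith


/-- Almost surely, as the integer `n → ∞`,
`(e^{-α n} / n) ∫_0^n L̃(s) X_s ds → (A_∞ / α + Z_∞) · ∫_0^1 L(s) ds`,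
where `L̃(t) := ∫_0^t L(s) ds`. -/
theorem stmt_18 {Ω : Type*} [MeasurableSpace Ω] (P : Measure Ω) [IsProbabilityMeasure P]
    (H : ℝ) (hH1 : 1 / 2 ≤ H) (hH2 : H < 1)
    (B : ℝ → Ω → ℝ)
    (hBmeas : ∀ t : ℝ, Measurable (B t))
    (hBgauss : ∀ (m : ℕ) (t : Fin m → ℝ) (c : Fin m → ℝ), (∀ i, 0 ≤ t i) →
      ∃ v : NNReal, Measure.map (fun ω => ∑ i, c i * B (t i) ω) P = gaussianReal 0 v)
    (hB0 : ∀ ω, B 0 ω = 0)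
    (hBcov : ∀ s t : ℝ, 0 ≤ s → 0 ≤ t →
      ∫ ω, B s ω * B t ω ∂P = 1 / 2 * (s ^ (2 * H) + t ^ (2 * H) - |t - s| ^ (2 * H)))
    (hBcont : ∀ᵐ ω ∂P, ContinuousOn (fun t => B t ω) (Set.Ici (0 : ℝ)))
    (α : ℝ) (hα : 0 < α)
    (Z : ℝ → Ω → ℝ)
    (hZ : ∀ (t : ℝ) (ω : Ω), Z t ω = ∫ s in (0:ℝ)..t, Real.exp (-α * s) * B s ω)
    (Zinf : Ω → ℝ)
    (hZinf : ∀ ω : Ω, Zinf ω = ∫ s in Set.Ioi (0:ℝ), Real.exp (-α * s) * B s ω)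
    (L : ℝ → ℝ)
    (hLmeas : Measurable L) (hLbdd : ∃ M : ℝ, ∀ t : ℝ, |L t| ≤ M)
    (hLper : ∀ t : ℝ, L (t + 1) = L t)
    (A : ℝ → ℝ) (hA : ∀ t : ℝ, A t = ∫ s in (0:ℝ)..t, Real.exp (-α * s) * L s)
    (Ainf : ℝ) (hAinf : Ainf = A 1 / (1 - Real.exp (-α)))
    (X : ℝ → Ω → ℝ)
    (hX : ∀ (t : ℝ) (ω : Ω), X t ω = Real.exp (α * t) * A t
        + α * Real.exp (α * t) * Z t ω + B t ω) :
    ∀ᵐ ω ∂P, Tendsto (fun n : ℕ => Real.exp (-α * n) / n *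
        ∫ s in (0:ℝ)..(n:ℝ), (∫ r in (0:ℝ)..s, L r) * X s ω)
      atTop (nhds ((Ainf / α + Zinf ω) * ∫ s in (0:ℝ)..1, L s)) := by
  obtain ⟨M, hM⟩ := hLbdd
  have hLi : ∀ a b, IntervalIntegrable L volume a b := fun a b =>
    (intervalIntegrable_const (c := M)).mono_fun hLmeas.aestronglyMeasurable
      (Eventually.of_forall fun t => (hM t).trans (le_abs_self M))
  have heLi : ∀ a b, IntervalIntegrable (fun s => Real.exp (-α * s) * L s) volume a b :=
    fun a b => (hLi a b).continuousOn_mul (by fun_prop)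
  have heLI : IntegrableOn (fun s => Real.exp (-α * s) * L s) (Set.Ioi 0) :=
    (exp_neg_integrableOn_Ioi 0 hα).mul_bdd (c := M) hLmeas.aestronglyMeasurable
      (Eventually.of_forall fun t => hM t)
  have hAI : ∫ s in Set.Ioi (0:ℝ), Real.exp (-α * s) * L s = Ainf := by
    rw [hAinf, hA]; exact aux_A hα heLi heLI hLper
  have hl : Continuous fun t => ∫ r in (0:ℝ)..t, L r :=
    intervalIntegral.continuous_primitive hLi 0
  have hlM : ∀ t, |∫ r in (0:ℝ)..t, L r| ≤ M * |t| := fun t => by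
    have := intervalIntegral.norm_integral_le_of_norm_le_const (a := 0) (b := t) (f := L)
      (C := M) (fun x _ => hM x)
    simpa using this
  filter_upwards [hBcont, aux_int P H hH1 B hBmeas hBcov hBcont α hα] with ω hc hI
  set b : ℝ → ℝ := fun s => B (max s 0) ω with hb
  have hbc : Continuous b := hc.comp_continuous (by fun_prop) (fun t => Set.mem_Ici.2 (le_max_right _ _))
  have hbB : ∀ s, 0 ≤ s → B s ω = b s := fun s hs => by simp only [hb, max_eq_left hs]
  have hebi : ∀ x y, IntervalIntegrable (fun s => Real.exp (-α * s) * b s) volume x y :=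
    fun x y => (by fun_prop : Continuous fun s => Real.exp (-α * s) * b s).intervalIntegrable _ _
  set h : ℝ → ℝ := fun s => Real.exp (-α * s) * L s + α * (Real.exp (-α * s) * b s) with hh
  have hhi : ∀ x y, IntervalIntegrable h volume x y := fun x y =>
    (heLi x y).add ((hebi x y).const_mul α)
  have hhI : IntegrableOn h (Set.Ioi 0) := heLI.add (hI.const_mul α)
  have hZinf' : Zinf ω = ∫ s in Set.Ioi (0:ℝ), Real.exp (-α * s) * b s := by
    rw [hZinf]
    refine setIntegral_congr_fun measurableSet_Ioi fun s hs => ?_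
    simp only [hbB s (le_of_lt hs)]
  have hhlim : ∫ s in Set.Ioi (0:ℝ), h s = Ainf + α * Zinf ω := by
    rw [hh, integral_add heLI (hI.const_mul α), hAI, integral_const_mul, hZinf']
  have hg : ∀ t, 0 ≤ t → A t + α * Z t ω = ∫ s in (0:ℝ)..t, h s := by
    intro t ht
    rw [hh, intervalIntegral.integral_add (heLi 0 t) ((hebi 0 t).const_mul α), hA, hZ,
      intervalIntegral.integral_const_mul]
    congr 2
    refine intervalIntegral.integral_congr fun s hs => ?_
    rw [Set.uIcc_of_le ht] at hs
    simp only [hbB s hs.1]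
  have c1 := aux_conv1 hα (fun t => ∫ r in (0:ℝ)..t, L r) (fun t => ∫ s in (0:ℝ)..t, h s) hl
    (intervalIntegral.continuous_primitive hhi 0) hlM
    (C := ∫ s in Set.Ioi (0:ℝ), ‖h s‖)
    (fun t ht => by
      refine (intervalIntegral.norm_integral_le_integral_norm (f := h) (μ := volume) ht).trans ?_
      rw [intervalIntegral.integral_of_le ht]
      exact setIntegral_mono_set hhI.norm (Eventually.of_forall fun _ => norm_nonneg _)
        (Set.Ioc_subset_Ioi_self.eventuallyLE))
    (aux_L hLi hLper) (intervalIntegral_tendsto_integral_Ioi 0 hhI tendsto_id)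
  have c2 := aux_conv2 hα (fun t => ∫ r in (0:ℝ)..t, L r) b hl hbc hlM hI
  have c3 := c1.add c2
  rw [hhlim, add_zero] at c3
  have : (Ainf + α * Zinf ω) / α = Ainf / α + Zinf ω := by field_simp
  rw [this] at c3
  refine c3.congr fun n => ?_
  rw [← mul_add, ← intervalIntegral.integral_add]
  · congr 1
    refine intervalIntegral.integral_congr fun s hs => ?_
    rw [Set.uIcc_of_le n.cast_nonneg] at hs
    simp only [hX, ← hg s hs.1, hbB s hs.1]
    ring
  · exact (hl.mul ((by fun_prop : Continuous fun s => Real.exp (α * s)).mul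
      (intervalIntegral.continuous_primitive hhi 0))).intervalIntegrable _ _
  · exact (hl.mul hbc).intervalIntegrable _ _
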